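/- arXiv:2104.04857 — 6 statements merged into one kernel-verified Lean document; each statement's English description precedes it below -/
import Mathlib

section
/- Let L > 0, λ ∈ {1, −1}, and let q₀ : [0, L] → ℂ be continuous. For each k ∈ ℂ let (μ¹(·,k), μ²(·,k)) be the unique continuous solution of the Volterra system. Then for each fixed x ∈ [0, L], the maps k ↦ μ¹(x,k) and k ↦ μ²(x,k) are entire functions of k (complex differentiable on all of ℂ); in particular, the spectral functions a(k) = μ²(0,k) and b(k) = μ¹(0,k) are entire. -/
open Complex intervalIntegral

/-- The Volterra integral system associated with the spectral analysis of the
x-periodic NLS equation. -/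
def IsVolterraSolution (L : ℝ) (lam : ℂ) (q0 : ℝ → ℂ) (k : ℂ)
    (μ1 μ2 : ℝ → ℂ) : Prop :=
  ContinuousOn μ1 (Set.Icc 0 L) ∧ ContinuousOn μ2 (Set.Icc 0 L) ∧
  ∀ x ∈ Set.Icc (0 : ℝ) L,
    μ1 x = -∫ y in x..L, Complex.exp (2 * Complex.I * k * ((y : ℂ) - (x : ℂ))) * q0 y * μ2 y ∧
    μ2 x = 1 - lam * ∫ y in x..L, (starRingEnd ℂ) (q0 y) * μ1 y

/-- The Volterra integration operator `f ↦ (x ↦ ∫ y in x..L, f y)` on `C([0, L], ℂ)`. -/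
noncomputable def tailIntegral (L : ℝ) (hL : 0 ≤ L) :
    C(Set.Icc (0 : ℝ) L, ℂ) →L[ℂ] C(Set.Icc (0 : ℝ) L, ℂ) :=
  LinearMap.mkContinuous
    { toFun := fun f =>
        ⟨fun x => ∫ y in (x : ℝ)..L, Set.IccExtend hL f y, by
          have h : Continuous fun t : ℝ => ∫ y in L..t, Set.IccExtend hL f y :=
            intervalIntegral.continuous_primitive
              (fun a b => (f.continuous.Icc_extend').intervalIntegrable a b) L
          simp_rw [intervalIntegral.integral_symm L]
          exact (h.comp continuous_subtype_val).neg⟩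
      map_add' := fun f g => by
        ext x
        exact intervalIntegral.integral_add (f.continuous.Icc_extend'.intervalIntegrable _ _)
          (g.continuous.Icc_extend'.intervalIntegrable _ _)
      map_smul' := fun c f => by
        ext x
        exact intervalIntegral.integral_smul c (Set.IccExtend hL f) }
    L (fun f => by
      rw [ContinuousMap.norm_le _ (by positivity)]
      intro x
      refine (intervalIntegral.norm_integral_le_of_norm_le_const
        (C := ‖f‖) fun y _ => f.norm_coe_le_norm _).trans ?_
      rw [abs_of_nonneg (by linarith [x.2.2]), mul_comm]
      gcongr
      linarith [x.2.1])

lemma tailIntegral_apply {L : ℝ} (hL : 0 ≤ L) (f : C(Set.Icc (0 : ℝ) L, ℂ))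
    (x : Set.Icc (0 : ℝ) L) :
    tailIntegral L hL f x = ∫ y in (x : ℝ)..L, Set.IccExtend hL f y := rfl

/-- Tail integrals may be computed from any function that agrees with `f` on `[0, L]`. -/
lemma tailIntegral_apply_of_eq {L : ℝ} (hL : 0 ≤ L) {f : C(Set.Icc (0 : ℝ) L, ℂ)} {g : ℝ → ℂ}
    (hfg : ∀ y : Set.Icc (0 : ℝ) L, f y = g y) (x : Set.Icc (0 : ℝ) L) :
    tailIntegral L hL f x = ∫ y in (x : ℝ)..L, g y := by
  rw [tailIntegral_apply]
  refine intervalIntegral.integral_congr fun y hy => ?_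
  rw [Set.uIcc_of_le x.2.2] at hy
  have hy' : y ∈ Set.Icc (0 : ℝ) L := ⟨x.2.1.trans hy.1, hy.2⟩
  simpa only [Set.IccExtend_of_mem hL f hy'] using hfg ⟨y, hy'⟩

/-- The function `x ↦ exp (c * x)` on `[0, L]`. -/
noncomputable def expOnIcc (L : ℝ) (c : ℂ) : C(Set.Icc (0 : ℝ) L, ℂ) :=
  NormedSpace.exp (c • ⟨fun x : Set.Icc (0 : ℝ) L => ((x : ℝ) : ℂ), by fun_prop⟩)

lemma expOnIcc_apply (L : ℝ) (c : ℂ) (x : Set.Icc (0 : ℝ) L) :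
    expOnIcc L c x = Complex.exp (c * (x : ℝ)) := by
  have h := NormedSpace.map_exp (ContinuousMap.evalAlgHom ℂ ℂ x)
    (continuous_eval_const x)
    (c • ⟨fun x : Set.Icc (0 : ℝ) L => ((x : ℝ) : ℂ), by fun_prop⟩)
  rw [Complex.exp_eq_exp_ℂ]
  exact h

lemma differentiable_expOnIcc (L : ℝ) : Differentiable ℂ (expOnIcc L) := fun c =>
  (hasDerivAt_exp_smul_const (𝕂 := ℂ) (𝔸 := C(Set.Icc (0 : ℝ) L, ℂ)) _ c).differentiableAt

lemma expOnIcc_mul_expOnIcc_neg (L : ℝ) (c : ℂ) : expOnIcc L c * expOnIcc L (-c) = 1 := by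
  ext x
  simp [expOnIcc_apply, ← Complex.exp_add]

/-- Conjugation by an exponential weight makes tail integration small. -/
lemma norm_expOnIcc_mul_tailIntegral_le {L : ℝ} (hL : 0 ≤ L) {β : ℝ} (hβ : 0 < β)
    (f : C(Set.Icc (0 : ℝ) L, ℂ)) :
    ‖expOnIcc L β * tailIntegral L hL (expOnIcc L (-β) * f)‖ ≤ β⁻¹ * ‖f‖ := by
  rw [ContinuousMap.norm_le _ (by positivity)]
  intro x
  have hint : ‖tailIntegral L hL (expOnIcc L (-β) * f) x‖ ≤
      ∫ y in (x : ℝ)..L, Real.exp (-β * y) * ‖f‖ := by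
    rw [tailIntegral_apply]
    refine intervalIntegral.norm_integral_le_of_norm_le x.2.2 (.of_forall fun y hy => ?_)
      (Continuous.intervalIntegrable (by fun_prop) _ _)
    have hy' : y ∈ Set.Icc (0 : ℝ) L := ⟨x.2.1.trans hy.1.le, hy.2⟩
    rw [Set.IccExtend_of_mem hL _ hy', ContinuousMap.mul_apply, norm_mul, expOnIcc_apply,
      Complex.norm_exp]
    have : ((-β : ℂ) * ((y : ℝ) : ℂ)).re = -β * y := by simp
    simp only [this]
    gcongr
    exact f.norm_coe_le_norm _
  have hval : ∫ y in (x : ℝ)..L, Real.exp (-β * y) * ‖f‖ =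
      β⁻¹ * (Real.exp (-β * x) - Real.exp (-β * L)) * ‖f‖ := by
    rw [intervalIntegral.integral_mul_const, intervalIntegral.integral_comp_mul_left
      (fun y => Real.exp y) (by linarith), integral_exp, smul_eq_mul, inv_neg]
    ring
  rw [ContinuousMap.mul_apply, norm_mul, expOnIcc_apply, Complex.norm_exp]
  have hre : ((β : ℂ) * ((x : ℝ) : ℂ)).re = β * x := by simp
  rw [hre]
  calc
    _ ≤ Real.exp (β * x) * (β⁻¹ * (Real.exp (-β * x) - Real.exp (-β * L)) * ‖f‖) := by
      gcongr
      exact hint.trans_eq hval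
    _ ≤ Real.exp (β * x) * (β⁻¹ * Real.exp (-β * x) * ‖f‖) := by
      gcongr
      linarith [Real.exp_pos (-β * L)]
    _ = β⁻¹ * ‖f‖ := by
      have : Real.exp (β * x) * Real.exp (-β * x) = 1 := by simp [← Real.exp_add]
      linear_combination (β⁻¹ * ‖f‖) * this

/-- If weights `w β` make `V` arbitrarily small by conjugation, then
`1 - V a V b` is invertible for all multipliers `a`, `b`. -/
lemma isUnit_one_sub_of_weights {A : Type*} [NormedCommRing A] [NormedAlgebra ℂ A]
    [CompleteSpace A] {V : A →L[ℂ] A} {w : ℝ → Aˣ}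
    (hw : ∀ β : ℝ, 0 < β → ∀ f, ‖(w β : A) * V (↑(w β)⁻¹ * f)‖ ≤ β⁻¹ * ‖f‖) (a b : A) :
    IsUnit (1 - V * ContinuousLinearMap.mul ℂ A a * V * ContinuousLinearMap.mul ℂ A b) := by
  set M := ContinuousLinearMap.mul ℂ A
  obtain ⟨β, hβ, hab⟩ : ∃ β : ℝ, 0 < β ∧ β⁻¹ * ‖a‖ * β⁻¹ * ‖b‖ < 1 := by
    refine ⟨1 + ‖a‖ + ‖b‖, by positivity, ?_⟩
    have h : 0 < 1 + ‖a‖ + ‖b‖ := by positivity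
    field_simp
    nlinarith [norm_nonneg a, norm_nonneg b, mul_nonneg (norm_nonneg a) (norm_nonneg b)]
  let W : (A →L[ℂ] A)ˣ :=
    ⟨M (w β), M ↑(w β)⁻¹, by ext1 f; exact (w β).mul_inv_cancel_left f,
      by ext1 f; exact (w β).inv_mul_cancel_left f⟩
  have hV : ‖W.val * V * W⁻¹.val‖ ≤ β⁻¹ :=
    ContinuousLinearMap.opNorm_le_bound _ (by positivity) (hw β hβ)
  have hcomm : ∀ g, W⁻¹.val * M g = M g * W⁻¹.val := fun g => by
    ext1 f
    exact mul_left_comm _ _ _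
  have hM : ∀ g, ‖M g‖ ≤ ‖g‖ := ContinuousLinearMap.opNorm_mul_apply_le ℂ A
  set U := W.val * V * W⁻¹.val with hU
  have hconj : 1 - V * M a * V * M b = W⁻¹.val * (1 - U * M a * U * M b) * W.val := by
    have h : U * M a * U * M b = W.val * (V * M a * V * M b) * W⁻¹.val := by
      simp only [hU, mul_assoc, hcomm, Units.inv_mul_cancel_left]
    rw [h, mul_sub, sub_mul]
    simp only [mul_assoc, Units.inv_mul, Units.inv_mul_cancel_left, mul_one]
  rw [hconj]
  suffices h : ‖U * M a * U * M b‖ < 1 from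
    (W⁻¹.isUnit.mul (isUnit_one_sub_of_norm_lt_one h)).mul W.isUnit
  calc
    ‖U * M a * U * M b‖ ≤ ‖U‖ * ‖M a‖ * ‖U‖ * ‖M b‖ := by
      refine (norm_mul_le _ _).trans ?_
      gcongr
      refine (norm_mul_le _ _).trans ?_
      gcongr
      exact norm_mul_le _ _
    _ ≤ β⁻¹ * ‖a‖ * β⁻¹ * ‖b‖ := by
      gcongr <;> apply hM
    _ < 1 := hab

/-- If `1 - T k` is invertible with `T` entire, the solutions of `u k - T k (u k) = v` are
entire in `k`. -/
lemma differentiable_of_one_sub_apply_eq {E : Type*} [NormedAddCommGroup E] [NormedSpace ℂ E]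
    [CompleteSpace E] {T : ℂ → E →L[ℂ] E} (hT : Differentiable ℂ T)
    (hunit : ∀ k, IsUnit (1 - T k)) {u : ℂ → E} {v : E} (hu : ∀ k, (1 - T k) (u k) = v) :
    Differentiable ℂ u := by
  have hinv : Differentiable ℂ fun k => Ring.inverse (1 - T k) := fun k => by
    obtain ⟨w, hw⟩ := hunit k
    have h : DifferentiableAt ℂ Ring.inverse (1 - T k) := by
      rw [← hw]
      exact differentiableAt_inverse ⟨w, rfl⟩
    exact h.comp k ((differentiable_const _).sub hT k)
  have huv : u = fun k => Ring.inverse (1 - T k) v := by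
    funext k
    rw [← hu k, ← mul_apply_eq_comp, Ring.inverse_mul_cancel _ (hunit k),
      one_apply_eq_self]
  rw [huv]
  exact hinv.clm_apply (differentiable_const v)

/-- Analytic dependence on `k` for the system `u = -eInv * V (e * q * v)`, `v = c - V (p * u)`. -/
lemma differentiable_of_volterra_system {A : Type*} [NormedCommRing A] [NormedAlgebra ℂ A]
    [CompleteSpace A] {V : A →L[ℂ] A} {w : ℝ → Aˣ}
    (hw : ∀ β : ℝ, 0 < β → ∀ f, ‖(w β : A) * V (↑(w β)⁻¹ * f)‖ ≤ β⁻¹ * ‖f‖)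
    {e eInv u v : ℂ → A} {c p q : A} (he : Differentiable ℂ e) (heInv : Differentiable ℂ eInv)
    (hu : ∀ k, u k = -(eInv k * V (e k * q * v k))) (hv : ∀ k, v k = c - V (p * u k)) :
    Differentiable ℂ u ∧ Differentiable ℂ v := by
  let M := ContinuousLinearMap.mul ℂ A
  let T : ℂ → A →L[ℂ] A := fun k => V * M (p * eInv k) * V * M (e k * q)
  have hT : Differentiable ℂ T := by
    have h1 : Differentiable ℂ fun k => M (p * eInv k) :=
      M.differentiable.comp ((differentiable_const _).mul heInv)
    have h2 : Differentiable ℂ fun k => M (e k * q) :=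
      M.differentiable.comp (he.mul (differentiable_const _))
    exact (((differentiable_const V).mul h1).mul (differentiable_const V)).mul h2
  have hTv : ∀ k, (1 - T k) (v k) = c := fun k => by
    change v k - V (p * eInv k * V (e k * q * v k)) = c
    have h := hv k
    rw [hu k, mul_neg, map_neg, sub_neg_eq_add, ← mul_assoc] at h
    rwa [sub_eq_iff_eq_add]
  have hvd : Differentiable ℂ v :=
    differentiable_of_one_sub_apply_eq hT (fun k => isUnit_one_sub_of_weights hw _ _) hTv
  refine ⟨?_, hvd⟩
  rw [funext hu]
  exact (heInv.mul (V.differentiable.comp ((he.mul (differentiable_const q)).mul hvd))).neg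

/-- If `(μ¹(·,k), μ²(·,k))` solves the Volterra system for each `k ∈ ℂ`, then for
each fixed `x ∈ [0,L]` the maps `k ↦ μ¹(x,k)` and `k ↦ μ²(x,k)` are entire; in
particular the spectral functions `a(k) = μ²(0,k)` and `b(k) = μ¹(0,k)` are entire. -/
theorem volterra_solution_entire (L : ℝ) (hL : 0 < L) (lam : ℂ)
    (hlam : lam = 1 ∨ lam = -1) (q0 : ℝ → ℂ)
    (hq0 : ContinuousOn q0 (Set.Icc 0 L))
    (μ1 μ2 : ℂ → ℝ → ℂ)
    (hsol : ∀ k : ℂ, IsVolterraSolution L lam q0 k (μ1 k) (μ2 k)) :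
    (∀ x ∈ Set.Icc (0 : ℝ) L,
      Differentiable ℂ (fun k : ℂ => μ1 k x) ∧
      Differentiable ℂ (fun k : ℂ => μ2 k x)) ∧
    Differentiable ℂ (fun k : ℂ => μ2 k 0) ∧
    Differentiable ℂ (fun k : ℂ => μ1 k 0) := by
  suffices h : ∀ x ∈ Set.Icc (0 : ℝ) L,
      Differentiable ℂ (fun k : ℂ => μ1 k x) ∧ Differentiable ℂ (fun k : ℂ => μ2 k x) from
    have h0 := h 0 ⟨le_rfl, hL.le⟩
    ⟨h, h0.2, h0.1⟩
  let V := tailIntegral L hL.le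
  let q : C(Set.Icc (0 : ℝ) L, ℂ) := ⟨_, hq0.domRestrict⟩
  let p : C(Set.Icc (0 : ℝ) L, ℂ) := lam • star q
  let u : ℂ → C(Set.Icc (0 : ℝ) L, ℂ) := fun k => ⟨_, (hsol k).1.domRestrict⟩
  let v : ℂ → C(Set.Icc (0 : ℝ) L, ℂ) := fun k => ⟨_, (hsol k).2.1.domRestrict⟩
  let e : ℂ → C(Set.Icc (0 : ℝ) L, ℂ) := fun k => expOnIcc L (2 * Complex.I * k)
  let eInv : ℂ → C(Set.Icc (0 : ℝ) L, ℂ) := fun k => expOnIcc L (-(2 * Complex.I * k))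
  have he : Differentiable ℂ e := (differentiable_expOnIcc L).comp (by fun_prop)
  have heInv : Differentiable ℂ eInv := (differentiable_expOnIcc L).comp (by fun_prop)
  have hu : ∀ k, u k = -(eInv k * V (e k * q * v k)) := fun k => by
    ext x
    change μ1 k x = -(eInv k x * V (e k * q * v k) x)
    have hV : V (e k * q * v k) x =
        ∫ y in (x : ℝ)..L, Complex.exp (2 * Complex.I * k * y) * q0 y * μ2 k y :=
      tailIntegral_apply_of_eq hL.le (fun y => by
        change e k y * q0 y * μ2 k y = _
        simp only [e, expOnIcc_apply]) x
    rw [((hsol k).2.2 x x.2).1, hV, ← intervalIntegral.integral_const_mul]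
    congr 1
    refine intervalIntegral.integral_congr fun y _ => ?_
    simp only [eInv, expOnIcc_apply, ← mul_assoc, ← Complex.exp_add]
    ring_nf
  have hv : ∀ k, v k = 1 - V (p * u k) := fun k => by
    ext x
    change μ2 k x = 1 - V (p * u k) x
    have hV : V (p * u k) x = ∫ y in (x : ℝ)..L, lam * ((starRingEnd ℂ) (q0 y) * μ1 k y) :=
      tailIntegral_apply_of_eq hL.le (fun y => mul_assoc _ _ _) x
    rw [hV, intervalIntegral.integral_const_mul, ((hsol k).2.2 x x.2).2]
  let w : ℝ → C(Set.Icc (0 : ℝ) L, ℂ)ˣ := fun β =>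
    ⟨expOnIcc L β, expOnIcc L (-β), expOnIcc_mul_expOnIcc_neg L β,
      by rw [mul_comm, expOnIcc_mul_expOnIcc_neg]⟩
  obtain ⟨hud, hvd⟩ := differentiable_of_volterra_system (V := V) (w := w)
    (fun β hβ f => norm_expOnIcc_mul_tailIntegral_le hL.le hβ f) he heInv hu hv
  intro x hx
  have hev := (ContinuousMap.evalCLM ℂ (⟨x, hx⟩ : Set.Icc (0 : ℝ) L) :
    C(Set.Icc (0 : ℝ) L, ℂ) →L[ℂ] ℂ).differentiable
  exact ⟨hev.comp hud, hev.comp hvd⟩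
end

section
/- Let L > 0, λ ∈ {1, −1}, and let q₀ : [0, L] → ℂ be continuous. Let a(k) = μ²(0,k) and b(k) = μ¹(0,k) be the spectral functions defined through the unique continuous solution of the Volterra system. Then for every k ∈ ℂ the unit determinant relation holds: a(k) · conj(a(conj(k))) − λ · b(k) · conj(b(conj(k))) = 1. -/
open Complex intervalIntegral

/-- Fundamental theorem of calculus in the lower endpoint, at interior points. -/
lemma hasDerivAt_integral_lower {L : ℝ} {f : ℝ → ℂ} (hf : ContinuousOn f (Set.Icc 0 L))
    {x : ℝ} (hx : x ∈ Set.Ioo 0 L) :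
    HasDerivAt (fun u => ∫ y in u..L, f y) (-f x) x := by
  refine integral_hasDerivAt_left ?_ ?_ ?_
  · refine ContinuousOn.intervalIntegrable_of_Icc hx.2.le (hf.mono ?_)
    exact Set.Icc_subset_Icc_left hx.1.le
  · exact (hf.mono Set.Ioo_subset_Icc_self).stronglyMeasurableAtFilter isOpen_Ioo x hx
  · exact hf.continuousAt (Icc_mem_nhds hx.1 hx.2)

/-- The differential form of the first Volterra equation. -/
lemma IsVolterraSolution.hasDerivAt_fst {L : ℝ} {lam : ℂ} {q0 : ℝ → ℂ} {k : ℂ}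
    {μ1 μ2 : ℝ → ℂ} (h : IsVolterraSolution L lam q0 k μ1 μ2)
    (hq0 : ContinuousOn q0 (Set.Icc 0 L)) {x : ℝ} (hx : x ∈ Set.Ioo 0 L) :
    HasDerivAt μ1 (-2 * I * k * μ1 x + q0 x * μ2 x) x := by
  obtain ⟨-, h2, heq⟩ := h
  set F : ℝ → ℂ := fun u => ∫ y in u..L, exp (2 * I * k * (y : ℂ)) * q0 y * μ2 y with hF
  have hμ : ∀ u ∈ Set.Icc 0 L, μ1 u = -(exp (-2 * I * k * (u : ℂ)) * F u) := by
    intro u hu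
    rw [(heq u hu).1, hF, ← integral_const_mul]
    congr 2
    ext y
    rw [← mul_assoc, ← mul_assoc, ← exp_add]
    congr 3
    ring
  have hFd : HasDerivAt F (-(exp (2 * I * k * (x : ℂ)) * q0 x * μ2 x)) x := by
    refine hasDerivAt_integral_lower (ContinuousOn.mul (ContinuousOn.mul ?_ hq0) h2) hx
    fun_prop
  have hE : HasDerivAt (fun u : ℝ => exp (-2 * I * k * (u : ℂ)))
      (exp (-2 * I * k * (x : ℂ)) * (-2 * I * k)) x := by
    simpa using ((hasDerivAt_id x).ofReal_comp.const_mul (-2 * I * k)).cexp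
  have hexp : exp (-2 * I * k * (x : ℂ)) * exp (2 * I * k * (x : ℂ)) = 1 := by
    rw [← exp_add, ← exp_zero]
    congr 1
    ring
  refine ((hE.mul hFd).neg.congr_of_eventuallyEq ?_).congr_deriv ?_
  · filter_upwards [Icc_mem_nhds hx.1 hx.2] with u hu using hμ u hu
  · rw [hμ x (Set.Ioo_subset_Icc_self hx)]
    linear_combination (q0 x * μ2 x) * hexp

/-- The differential form of the second Volterra equation. -/
lemma IsVolterraSolution.hasDerivAt_snd {L : ℝ} {lam : ℂ} {q0 : ℝ → ℂ} {k : ℂ}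
    {μ1 μ2 : ℝ → ℂ} (h : IsVolterraSolution L lam q0 k μ1 μ2)
    (hq0 : ContinuousOn q0 (Set.Icc 0 L)) {x : ℝ} (hx : x ∈ Set.Ioo 0 L) :
    HasDerivAt μ2 (lam * ((starRingEnd ℂ) (q0 x) * μ1 x)) x := by
  obtain ⟨h1, -, heq⟩ := h
  have hd := hasDerivAt_integral_lower ((continuous_conj.comp_continuousOn hq0).mul h1) hx
  refine (((hd.const_mul lam).const_sub 1).congr_of_eventuallyEq ?_).congr_deriv ?_
  · filter_upwards [Icc_mem_nhds hx.1 hx.2] with u hu using (heq u hu).2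
  · simp

/-- The unit determinant relation `a(k) conj(a(conj k)) - λ b(k) conj(b(conj k)) = 1`
for the spectral functions `a(k) = μ²(0,k)`, `b(k) = μ¹(0,k)` of the Volterra system. -/
theorem spectral_functions_unit_determinant (L : ℝ) (hL : 0 < L) (lam : ℂ)
    (hlam : lam = 1 ∨ lam = -1) (q0 : ℝ → ℂ)
    (hq0 : ContinuousOn q0 (Set.Icc 0 L))
    (μ1 μ2 : ℂ → ℝ → ℂ)
    (hsol : ∀ k : ℂ, IsVolterraSolution L lam q0 k (μ1 k) (μ2 k))
    (a b : ℂ → ℂ)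
    (ha : ∀ k : ℂ, a k = μ2 k 0) (hb : ∀ k : ℂ, b k = μ1 k 0) :
    ∀ k : ℂ,
      a k * (starRingEnd ℂ) (a ((starRingEnd ℂ) k)) -
        lam * (b k * (starRingEnd ℂ) (b ((starRingEnd ℂ) k))) = 1 := by
  intro k
  have hlam' : (starRingEnd ℂ) lam = lam := by rcases hlam with rfl | rfl <;> simp
  set k' := (starRingEnd ℂ) k with hk'
  set D : ℝ → ℂ := fun x => μ2 k x * (starRingEnd ℂ) (μ2 k' x) -
    lam * (μ1 k x * (starRingEnd ℂ) (μ1 k' x)) with hD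
  have hcont : ContinuousOn D (Set.Icc 0 L) := by
    have h1 := (hsol k).1
    have h2 := (hsol k).2.1
    have h1' := continuous_conj.comp_continuousOn (hsol k').1
    have h2' := continuous_conj.comp_continuousOn (hsol k').2.1
    exact (h2.mul h2').sub (continuousOn_const.mul (h1.mul h1'))
  have hderiv : ∀ x ∈ Set.Ioo 0 L, HasDerivAt D 0 x := by
    intro x hx
    have d1 := (hsol k).hasDerivAt_fst hq0 hx
    have d2 := (hsol k).hasDerivAt_snd hq0 hx
    have d1' := ((hsol k').hasDerivAt_fst hq0 hx).star
    have d2' := ((hsol k').hasDerivAt_snd hq0 hx).star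
    refine ((d2.mul d2').sub ((d1.mul d1').const_mul lam)).congr_deriv ?_
    simp only [← starRingEnd_apply, map_add, map_mul, map_neg, conj_I, hlam', hk', conj_conj,
      map_ofNat]
    ring
  have hconst : D L = D 0 := by
    have h := integral_eq_sub_of_hasDerivAt_of_le hL.le hcont hderiv
      intervalIntegrable_const
    rw [integral_zero] at h
    exact sub_eq_zero.mp h.symm
  have hend : D L = 1 := by
    have hLL : L ∈ Set.Icc 0 L := Set.right_mem_Icc.mpr hL.le
    have h1 (κ : ℂ) : μ1 κ L = 0 := by simpa using ((hsol κ).2.2 L hLL).1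
    have h2 (κ : ℂ) : μ2 κ L = 1 := by simpa using ((hsol κ).2.2 L hLL).2
    simp [hD, h1, h2]
  simp only [ha, hb]
  exact hconst.symm.trans hend
end

section
/- Let L > 0, λ ∈ {1, −1}, and q₀ > 0 a real constant, and consider the Volterra system with constant data q₀(x) ≡ q₀. For any k, w ∈ ℂ with w² = k² − λ q₀² and w ≠ 0, the functions μ¹(x,k) = −q₀ e^{ik(L−x)} sin((L−x) w)/w and μ²(x,k) = e^{ik(L−x)} (cos((L−x) w) − i k sin((L−x) w)/w), x ∈ [0, L], satisfy the Volterra system; consequently the spectral functions are a(k) = e^{ikL} (cos(L w) − i k sin(L w)/w) and b(k) = −q₀ e^{ikL} sin(L w)/w. -/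
open Complex intervalIntegral

/-- The first component satisfies `∂ₓ μ¹ = -2ik μ¹ + q μ²`, written with the integrating factor
`e^{2ik(y-x)}`. -/
lemma hasDerivAt_exp_mul_volterra_fst (L x y : ℝ) (q k w : ℂ) (hw0 : w ≠ 0) :
    HasDerivAt (fun y : ℝ => exp (2 * I * k * ((y : ℂ) - x)) *
        (-q * exp (I * k * ((L : ℂ) - y)) * sin (((L : ℂ) - y) * w) / w))
      (exp (2 * I * k * ((y : ℂ) - x)) * q * (exp (I * k * ((L : ℂ) - y)) *
        (cos (((L : ℂ) - y) * w) - I * k * sin (((L : ℂ) - y) * w) / w))) y := by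
  have hy : HasDerivAt (fun y : ℝ => (y : ℂ)) 1 y := ofRealCLM.hasDerivAt
  have hs := hy.const_sub (L : ℂ)
  have hfactor := ((hy.sub_const (x : ℂ)).const_mul (2 * I * k)).cexp
  have hexp := (hs.const_mul (I * k)).cexp
  have hsin := (hasDerivAt_sin _).comp y (hs.mul_const w)
  refine (hfactor.mul (((hexp.const_mul (-q)).mul hsin).div_const w)).congr_deriv ?_
  simp only [Pi.mul_apply, Function.comp_apply]
  field_simp
  ring

/-- The second component satisfies `∂ₓ μ² = λ q μ¹`. -/
lemma hasDerivAt_volterra_snd (L y : ℝ) (lam q k w : ℂ)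
    (hw : w ^ 2 = k ^ 2 - lam * q ^ 2) (hw0 : w ≠ 0) :
    HasDerivAt (fun y : ℝ => exp (I * k * ((L : ℂ) - y)) *
        (cos (((L : ℂ) - y) * w) - I * k * sin (((L : ℂ) - y) * w) / w))
      (lam * (q * (-q * exp (I * k * ((L : ℂ) - y)) * sin (((L : ℂ) - y) * w) / w))) y := by
  have hs := (ofRealCLM.hasDerivAt (x := y)).const_sub (L : ℂ)
  simp only [ofRealCLM_apply, ofReal_one] at hs
  have hexp := (hs.const_mul (I * k)).cexp
  have hsin := (hasDerivAt_sin _).comp y (hs.mul_const w)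
  have hcos := (hasDerivAt_cos _).comp y (hs.mul_const w)
  refine (hexp.mul (hcos.sub ((hsin.const_mul (I * k)).div_const w))).congr_deriv ?_
  simp only [Pi.sub_apply, Function.comp_apply]
  field_simp
  linear_combination sin (((L : ℂ) - y) * w) * (hw + k ^ 2 * I_sq)

/-- For constant initial data `q₀ > 0`, the explicit functions
`μ¹(x,k) = -q₀ e^{ik(L-x)} sin((L-x)w)/w` and
`μ²(x,k) = e^{ik(L-x)} (cos((L-x)w) - ik sin((L-x)w)/w)`, with `w² = k² - λq₀²`,
solve the Volterra system; consequently `a(k) = e^{ikL}(cos(Lw) - ik sin(Lw)/w)`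
and `b(k) = -q₀ e^{ikL} sin(Lw)/w`. -/
theorem volterra_constant_data (L : ℝ) (hL : 0 < L) (lam : ℂ)
    (hlam : lam = 1 ∨ lam = -1) (q0 : ℝ) (hq0 : 0 < q0) (k w : ℂ)
    (hw : w ^ 2 = k ^ 2 - lam * (q0 : ℂ) ^ 2) (hw0 : w ≠ 0) :
    IsVolterraSolution L lam (fun _ => (q0 : ℂ)) k
      (fun x : ℝ => -(q0 : ℂ) * Complex.exp (Complex.I * k * ((L : ℂ) - (x : ℂ))) *
        Complex.sin (((L : ℂ) - (x : ℂ)) * w) / w)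
      (fun x : ℝ => Complex.exp (Complex.I * k * ((L : ℂ) - (x : ℂ))) *
        (Complex.cos (((L : ℂ) - (x : ℂ)) * w)
          - Complex.I * k * Complex.sin (((L : ℂ) - (x : ℂ)) * w) / w)) ∧
    (fun x : ℝ => Complex.exp (Complex.I * k * ((L : ℂ) - (x : ℂ))) *
        (Complex.cos (((L : ℂ) - (x : ℂ)) * w)
          - Complex.I * k * Complex.sin (((L : ℂ) - (x : ℂ)) * w) / w)) 0
      = Complex.exp (Complex.I * k * (L : ℂ)) *
          (Complex.cos ((L : ℂ) * w) - Complex.I * k * Complex.sin ((L : ℂ) * w) / w) ∧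
    (fun x : ℝ => -(q0 : ℂ) * Complex.exp (Complex.I * k * ((L : ℂ) - (x : ℂ))) *
        Complex.sin (((L : ℂ) - (x : ℂ)) * w) / w) 0
      = -(q0 : ℂ) * Complex.exp (Complex.I * k * (L : ℂ)) * Complex.sin ((L : ℂ) * w) / w := by
  refine ⟨⟨by fun_prop, by fun_prop, fun x _ => ⟨?_, ?_⟩⟩, by simp, by simp⟩
  · rw [integral_eq_sub_of_hasDerivAt
      (fun y _ => hasDerivAt_exp_mul_volterra_fst L x y q0 k w hw0)
      (Continuous.intervalIntegrable (by fun_prop) _ _)]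
    simp
  · rw [← integral_const_mul]
    simp only [conj_ofReal]
    rw [integral_eq_sub_of_hasDerivAt
      (fun y _ => hasDerivAt_volterra_snd L y lam q0 k w hw hw0)
      (Continuous.intervalIntegrable (by fun_prop) _ _)]
    simp
end

section
/- Let L > 0, λ ∈ {1, −1}, q₀ > 0, and let P : ℂ → ℂ be the entire function satisfying P(k) = 4 − 4 cos²(L w) for every k, w ∈ ℂ with w² = k² − λ q₀². Then: (i) if k₀ ∈ ℂ satisfies k₀² = λ q₀², then P(k₀) = 0 and P′(k₀) ≠ 0 (a simple zero); (ii) if k₀ ∈ ℂ satisfies k₀ ≠ 0 and k₀² = λ q₀² + n² π² / L² for some nonzero integer n, then P(k₀) = 0, P′(k₀) = 0, and P″(k₀) ≠ 0 (a double zero). -/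
open Complex

/-- The curve `w² = k² - c²` is parametrized by `k = c cos t`, `w = i c sin t`, so a function
of `k` equal to `4 - 4cos²(Lw)` on the curve pulls back to an explicit function of `t`. -/
lemma eval_mul_cos {L c : ℂ} {P : ℂ → ℂ}
    (hP : ∀ k w : ℂ, w ^ 2 = k ^ 2 - c ^ 2 → P k = 4 - 4 * cos (L * w) ^ 2) (t : ℂ) :
    P (c * cos t) = 4 - 4 * cos (L * (I * c * sin t)) ^ 2 := by
  apply hP
  linear_combination (c ^ 2 * sin t ^ 2) * I_sq - c ^ 2 * sin_sq_add_cos_sq t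

lemma hasDerivAt_mul_cos (c t : ℂ) : HasDerivAt (fun s => c * cos s) (c * -sin t) t :=
  (hasDerivAt_cos t).const_mul c

lemma hasDerivAt_mul_sin (c t : ℂ) : HasDerivAt (fun s => c * sin s) (c * cos t) t :=
  (hasDerivAt_sin t).const_mul c

/-- First derivative of the relation `eval_mul_cos`, divided by `c`. -/
lemma deriv_mul_sin {L c : ℂ} {P : ℂ → ℂ} (hc : c ≠ 0) (hd : Differentiable ℂ P)
    (hP : ∀ k w : ℂ, w ^ 2 = k ^ 2 - c ^ 2 → P k = 4 - 4 * cos (L * w) ^ 2) (t : ℂ) :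
    deriv P (c * cos t) * sin t =
      -(8 * (L * I) * (cos (L * I * c * sin t) * sin (L * I * c * sin t) * cos t)) := by
  have hleft := (hd (c * cos t)).hasDerivAt.comp t (hasDerivAt_mul_cos c t)
  have hright := (((hasDerivAt_mul_sin (L * I * c) t).ccos.pow 2).const_mul 4).const_sub 4
  have hfun : (P ∘ fun s => c * cos s) = fun s => 4 - 4 * cos (L * I * c * sin s) ^ 2 := by
    funext s
    simpa only [mul_assoc, Function.comp_apply] using eval_mul_cos hP s
  rw [hfun] at hleft
  have h := hleft.unique hright
  apply mul_left_cancel₀ hc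
  simp only [Nat.cast_ofNat, Nat.add_one_sub_one, pow_one] at h
  linear_combination -h

/-- At a point of the curve where `sin (Lw) = 0`, the second derivative of the relation
`eval_mul_cos` loses its lower-order term. -/
lemma deriv_mul_cos_sub_deriv_deriv_mul_sin_sq {L c : ℂ} {P : ℂ → ℂ} (hc : c ≠ 0)
    (hd : Differentiable ℂ P)
    (hP : ∀ k w : ℂ, w ^ 2 = k ^ 2 - c ^ 2 → P k = 4 - 4 * cos (L * w) ^ 2) {t : ℂ}
    (hsin : sin (L * I * c * sin t) = 0) :
    deriv P (c * cos t) * cos t - c * deriv (deriv P) (c * cos t) * sin t ^ 2 =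
      8 * L ^ 2 * c * cos t ^ 2 := by
  have hd' : Differentiable ℂ (deriv P) := hd.deriv
  have hleft := ((hd' (c * cos t)).hasDerivAt.comp t (hasDerivAt_mul_cos c t)).mul
    (hasDerivAt_sin t)
  have hinner := hasDerivAt_mul_sin (L * I * c) t
  have hright := (((hinner.ccos.mul hinner.csin).mul
    (hasDerivAt_cos t)).const_mul (8 * (L * I))).neg
  have h := hleft.unique (hright.congr_of_eventuallyEq (Filter.Eventually.of_forall
    (deriv_mul_sin hc hd hP)))
  simp only [Function.comp_apply, Pi.mul_apply, hsin] at h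
  have hcos := sin_sq_add_cos_sq (L * I * c * sin t)
  rw [hsin] at hcos
  linear_combination h - 8 * L ^ 2 * I ^ 2 * c * cos t ^ 2 * hcos -
    8 * L ^ 2 * c * cos t ^ 2 * I_sq

/-- For the entire function `P = 4 - Δ² = 4 - 4cos²(Lw)`, `w² = k² - λq₀²`, of the
x-periodic NLS problem with constant initial data `q₀ > 0`: the zeros with
`k₀² = λq₀²` are simple, and the nonzero zeros with `k₀² = λq₀² + n²π²/L²`,
`n ∈ ℤ \ {0}`, are double. -/
theorem simple_and_double_zeros (L : ℝ) (hL : 0 < L) (lam : ℂ)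
    (hlam : lam = 1 ∨ lam = -1) (q0 : ℝ) (hq0 : 0 < q0)
    (P : ℂ → ℂ) (hPentire : Differentiable ℂ P)
    (hP : ∀ k w : ℂ, w ^ 2 = k ^ 2 - lam * (q0 : ℂ) ^ 2 →
      P k = 4 - 4 * Complex.cos ((L : ℂ) * w) ^ 2) :
    (∀ k0 : ℂ, k0 ^ 2 = lam * (q0 : ℂ) ^ 2 →
      P k0 = 0 ∧ deriv P k0 ≠ 0) ∧
    (∀ k0 : ℂ, k0 ≠ 0 →
      (∃ n : ℤ, n ≠ 0 ∧
        k0 ^ 2 = lam * (q0 : ℂ) ^ 2 + (n : ℂ) ^ 2 * (Real.pi : ℂ) ^ 2 / (L : ℂ) ^ 2) →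
      P k0 = 0 ∧ deriv P k0 = 0 ∧ deriv (deriv P) k0 ≠ 0) := by
  have hq : (q0 : ℂ) ≠ 0 := by exact_mod_cast hq0.ne'
  have hL' : (L : ℂ) ≠ 0 := by exact_mod_cast hL.ne'
  have hlam0 : lam ≠ 0 := by rcases hlam with rfl | rfl <;> simp
  have hne : lam * (q0 : ℂ) ^ 2 ≠ 0 := mul_ne_zero hlam0 (pow_ne_zero 2 hq)
  have hsqrt_ne : ∀ c : ℂ, c ^ 2 = lam * (q0 : ℂ) ^ 2 → c ≠ 0 := by
    rintro c hc rfl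
    exact hne (by simpa using hc.symm)
  constructor
  · intro c hc
    have hc0 := hsqrt_ne c hc
    rw [← hc] at hP
    refine ⟨by simpa using hP c 0 (by ring), fun hzero => ?_⟩
    have h := deriv_mul_cos_sub_deriv_deriv_mul_sin_sq (t := 0) hc0 hPentire hP (by simp)
    simp [hzero, hL', hc0] at h
  · rintro k0 hk0 ⟨n, hn, hk⟩
    obtain ⟨c, hc⟩ := IsAlgClosed.exists_pow_nat_eq (lam * (q0 : ℂ) ^ 2) two_pos
    have hc0 := hsqrt_ne c hc
    rw [← hc] at hP hk
    obtain ⟨t, ht⟩ := cos_surjective (k0 / c)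
    obtain rfl : k0 = c * cos t := by rw [ht]; field_simp
    have hpi : (Real.pi : ℂ) ≠ 0 := by exact_mod_cast Real.pi_ne_zero
    have hn' : (n : ℂ) ≠ 0 := by exact_mod_cast hn
    have hsq : (L * I * c * sin t) ^ 2 = (n * Real.pi : ℂ) ^ 2 := by
      field_simp at hk
      linear_combination hk + L ^ 2 * c ^ 2 * sin t ^ 2 * I_sq -
        L ^ 2 * c ^ 2 * sin_sq_add_cos_sq t
    have hsin : sin (L * I * c * sin t) = 0 := by
      rcases sq_eq_sq_iff_eq_or_eq_neg.mp hsq with h | h <;> simp [h, sin_int_mul_pi]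
    have ht0 : sin t ≠ 0 := by
      intro h
      rw [h] at hsq
      exact pow_ne_zero 2 (mul_ne_zero hn' hpi) (by simpa using hsq.symm)
    have hderiv : deriv P (c * cos t) = 0 := by
      have h := deriv_mul_sin hc0 hPentire hP t
      rw [hsin] at h
      simpa [ht0] using h
    refine ⟨?_, hderiv, fun hzero => ?_⟩
    · have h := eval_mul_cos hP t
      simp only [← mul_assoc] at h
      rw [h, cos_sq', hsin]
      ring
    · have h := deriv_mul_cos_sub_deriv_deriv_mul_sin_sq hc0 hPentire hP hsin
      rw [hzero, hderiv] at h
      have hcos : cos t ≠ 0 := right_ne_zero_of_mul hk0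
      simp [hL', hc0, hcos] at h
end

section
/- Let L > 0, λ ∈ {1, −1}, q₀ > 0, and k, w ∈ ℂ with w² = k² − λ q₀², w ≠ 0, and sin(L w) ≠ 0. Let a(k) = e^{ikL}(cos(L w) − i k sin(L w)/w) and b(k) = −q₀ e^{ikL} sin(L w)/w be the constant-data spectral functions, and set ā(k) = conj(a(conj(k))), b̄(k) = conj(b(conj(k))). Then with the branch choice √(4 − Δ(k)²) = 2 sin(L w), the function Γ̃(k) = (λ / (2 e^{ikL} b̄(k))) (ā(k) e^{ikL} − a(k) e^{−ikL} − 2 i sin(L w)) equals −λ i (k − w)/q₀. -/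
open Complex

/-- For constant initial data `q₀ > 0` the function `Γ̃` of the unified transform,
defined with the branch choice `√(4 - Δ²) = 2 sin(Lw)`, is given explicitly by
`Γ̃(k) = -λi(k - w)/q₀`, where `w² = k² - λq₀²`. -/
theorem tildeGamma_constant_data (L : ℝ) (hL : 0 < L) (lam : ℂ)
    (hlam : lam = 1 ∨ lam = -1) (q0 : ℝ) (hq0 : 0 < q0)
    (a b : ℂ → ℂ)
    (ha : ∀ k w : ℂ, w ^ 2 = k ^ 2 - lam * (q0 : ℂ) ^ 2 → w ≠ 0 →
      a k = Complex.exp (Complex.I * k * (L : ℂ)) *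
        (Complex.cos ((L : ℂ) * w) - Complex.I * k * Complex.sin ((L : ℂ) * w) / w))
    (hb : ∀ k w : ℂ, w ^ 2 = k ^ 2 - lam * (q0 : ℂ) ^ 2 → w ≠ 0 →
      b k = -(q0 : ℂ) * Complex.exp (Complex.I * k * (L : ℂ)) *
        Complex.sin ((L : ℂ) * w) / w) :
    ∀ k w : ℂ, w ^ 2 = k ^ 2 - lam * (q0 : ℂ) ^ 2 → w ≠ 0 →
      Complex.sin ((L : ℂ) * w) ≠ 0 →
      (lam / (2 * Complex.exp (Complex.I * k * (L : ℂ)) *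
          (starRingEnd ℂ) (b ((starRingEnd ℂ) k)))) *
        ((starRingEnd ℂ) (a ((starRingEnd ℂ) k)) * Complex.exp (Complex.I * k * (L : ℂ))
          - a k * Complex.exp (-Complex.I * k * (L : ℂ))
          - 2 * Complex.I * Complex.sin ((L : ℂ) * w))
      = -lam * Complex.I * (k - w) / (q0 : ℂ) := by
  intro k w hw hw0 hs
  have hw_conj : (starRingEnd ℂ) w ^ 2 = (starRingEnd ℂ) k ^ 2 - lam * (q0 : ℂ) ^ 2 := by
    have hlam_conj : (starRingEnd ℂ) lam = lam := by
      rcases hlam with rfl | rfl <;> simp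
    simpa [hlam_conj] using congrArg (starRingEnd ℂ) hw
  have hw0_conj : (starRingEnd ℂ) w ≠ 0 := by simpa using hw0
  have ha_bar : (starRingEnd ℂ) (a ((starRingEnd ℂ) k)) =
      Complex.exp (-Complex.I * k * (L : ℂ)) *
        (Complex.cos ((L : ℂ) * w) + Complex.I * k * Complex.sin ((L : ℂ) * w) / w) := by
    rw [ha _ _ hw_conj hw0_conj]
    simp [← Complex.exp_conj, ← Complex.cos_conj, ← Complex.sin_conj, neg_div]
  have hb_bar : (starRingEnd ℂ) (b ((starRingEnd ℂ) k)) =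
      -(q0 : ℂ) * Complex.exp (-Complex.I * k * (L : ℂ)) *
        Complex.sin ((L : ℂ) * w) / w := by
    rw [hb _ _ hw_conj hw0_conj]
    simp [← Complex.exp_conj, ← Complex.sin_conj]
  have hexp : Complex.exp (-Complex.I * k * (L : ℂ)) =
      (Complex.exp (Complex.I * k * (L : ℂ)))⁻¹ := by
    rw [← Complex.exp_neg]
    congr 1
    ring
  have hE := Complex.exp_ne_zero (Complex.I * k * (L : ℂ))
  have hq : (q0 : ℂ) ≠ 0 := by exact_mod_cast hq0.ne'
  rw [ha_bar, hb_bar, ha k w hw hw0, hexp]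
  generalize Complex.exp (Complex.I * k * (L : ℂ)) = E at hE ⊢
  generalize Complex.sin ((L : ℂ) * w) = s at hs ⊢
  field_simp
  ring
end

section
/- For all real numbers q₀ > 0, L > 0, x, and t, the function s ↦ (ln(2√(q₀² − s²)/q₀) − 2i(s x + 2 s² t − s L)) / √(q₀² − s²) is integrable on (−q₀, q₀) and exp( (1/(2π)) ∫_{−q₀}^{q₀} (ln(2√(q₀² − s²)/q₀) − 2i(s x + 2 s² t − s L)) / √(q₀² − s²) ds ) = e^{−i q₀² t}. -/
open Complex intervalIntegral Real

open MeasureTheory Set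

/-- The substitution `s = -q cos θ` turns `ds / √(q² - s²)` into `dθ`. -/
lemma deriv_smul_div_sqrt_comp_neg_mul_cos {q θ : ℝ} (hq : 0 < q) (hθ : θ ∈ Ioo 0 π)
    (h : ℝ → ℝ → ℂ) :
    (q * Real.sin θ) • (h (-q * Real.cos θ) √(q ^ 2 - (-q * Real.cos θ) ^ 2)
        / (√(q ^ 2 - (-q * Real.cos θ) ^ 2) : ℂ))
      = h (-q * Real.cos θ) (q * Real.sin θ) := by
  have hpos : 0 < q * Real.sin θ := mul_pos hq (Real.sin_pos_of_mem_Ioo hθ)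
  have hsqrt : √(q ^ 2 - (-q * Real.cos θ) ^ 2) = q * Real.sin θ := by
    rw [show q ^ 2 - (-q * Real.cos θ) ^ 2 = (q * Real.sin θ) ^ 2 by
      linear_combination (-q ^ 2) * Real.sin_sq_add_cos_sq θ]
    exact Real.sqrt_sq hpos.le
  rw [hsqrt, Complex.real_smul, mul_div_cancel₀]
  exact_mod_cast hpos.ne'

lemma hasDerivAt_neg_mul_cos (q θ : ℝ) :
    HasDerivAt (fun θ => -q * Real.cos θ) (q * Real.sin θ) θ := by
  simpa using (Real.hasDerivAt_cos θ).const_mul (-q)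

lemma intervalIntegrable_div_sqrt_iff {q : ℝ} (hq : 0 < q) (h : ℝ → ℝ → ℂ) :
    IntervalIntegrable (fun s => h s √(q ^ 2 - s ^ 2) / (√(q ^ 2 - s ^ 2) : ℂ)) volume (-q) q ↔
      IntervalIntegrable (fun θ => h (-q * Real.cos θ) (q * Real.sin θ)) volume 0 π := by
  have key := integrableOn_Icc_deriv_smul_iff_of_deriv_nonneg (a := 0) (b := π)
    (g := fun s => h s √(q ^ 2 - s ^ 2) / (√(q ^ 2 - s ^ 2) : ℂ))
    (f := fun θ => -q * Real.cos θ) (f' := fun θ => q * Real.sin θ) (by fun_prop)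
    (fun θ _ => hasDerivAt_neg_mul_cos q θ)
    (fun θ hθ => (mul_pos hq (Real.sin_pos_of_mem_Ioo hθ)).le) Real.pi_pos.le
  simp only [Real.cos_zero, Real.cos_pi, mul_one, mul_neg, neg_neg] at key
  rw [intervalIntegrable_iff_integrableOn_Icc_of_le (by linarith),
    intervalIntegrable_iff_integrableOn_Ioo_of_le Real.pi_pos.le, ← key,
    integrableOn_Icc_iff_integrableOn_Ioo]
  exact integrableOn_congr_fun
    (fun θ hθ => deriv_smul_div_sqrt_comp_neg_mul_cos hq hθ h) measurableSet_Ioo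

lemma integral_div_sqrt_eq {q : ℝ} (hq : 0 < q) (h : ℝ → ℝ → ℂ) :
    ∫ s in (-q)..q, h s √(q ^ 2 - s ^ 2) / (√(q ^ 2 - s ^ 2) : ℂ) =
      ∫ θ in 0..π, h (-q * Real.cos θ) (q * Real.sin θ) := by
  have key := integral_Icc_deriv_smul_of_deriv_nonneg (a := 0) (b := π)
    (g := fun s => h s √(q ^ 2 - s ^ 2) / (√(q ^ 2 - s ^ 2) : ℂ))
    (f := fun θ => -q * Real.cos θ) (f' := fun θ => q * Real.sin θ) (by fun_prop)
    (fun θ _ => hasDerivAt_neg_mul_cos q θ)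
    (fun θ hθ => (mul_pos hq (Real.sin_pos_of_mem_Ioo hθ)).le) Real.pi_pos.le
  simp only [Real.cos_zero, Real.cos_pi, mul_one, mul_neg, neg_neg] at key
  rw [intervalIntegral.integral_of_le (by linarith), ← integral_Icc_eq_integral_Ioc, ← key,
    intervalIntegral.integral_of_le Real.pi_pos.le, integral_Icc_eq_integral_Ioo,
    integral_Ioc_eq_integral_Ioo]
  exact setIntegral_congr_fun measurableSet_Ioo
    (fun θ hθ => deriv_smul_div_sqrt_comp_neg_mul_cos hq hθ h)

lemma log_two_mul_mul_sin_div {q θ : ℝ} (hq : 0 < q) (hθ : θ ∈ Ioo 0 π) :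
    Real.log (2 * (q * Real.sin θ) / q) = Real.log 2 + Real.log (Real.sin θ) := by
  rw [← Real.log_mul two_ne_zero (Real.sin_pos_of_mem_Ioo hθ).ne']
  congr 1
  field_simp

lemma intervalIntegrable_log_two_mul_mul_sin_div {q : ℝ} (hq : 0 < q) :
    IntervalIntegrable (fun θ => Real.log (2 * (q * Real.sin θ) / q)) volume 0 π := by
  have hsum : IntervalIntegrable (fun θ => Real.log 2 + Real.log (Real.sin θ)) volume 0 π :=
    intervalIntegrable_const.add intervalIntegrable_log_sin
  rw [intervalIntegrable_iff_integrableOn_Ioo_of_le Real.pi_pos.le] at hsum ⊢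
  exact hsum.congr_fun (fun θ hθ => (log_two_mul_mul_sin_div hq hθ).symm) measurableSet_Ioo

lemma integral_log_two_mul_mul_sin_div {q : ℝ} (hq : 0 < q) :
    ∫ θ in 0..π, Real.log (2 * (q * Real.sin θ) / q) = 0 := by
  have hcongr : ∫ θ in 0..π, Real.log (2 * (q * Real.sin θ) / q) =
      ∫ θ in 0..π, (Real.log 2 + Real.log (Real.sin θ)) := by
    simp only [intervalIntegral.integral_of_le Real.pi_pos.le, integral_Ioc_eq_integral_Ioo]
    exact setIntegral_congr_fun measurableSet_Ioo (fun θ hθ => log_two_mul_mul_sin_div hq hθ)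
  have hlog : IntervalIntegrable (fun θ => Real.log (Real.sin θ)) volume 0 π :=
    intervalIntegrable_log_sin
  rw [hcongr, intervalIntegral.integral_add intervalIntegrable_const hlog,
    integral_log_sin_zero_pi, intervalIntegral.integral_const, smul_eq_mul]
  ring

lemma integral_phase_neg_mul_cos (q L x t : ℝ) :
    ∫ θ in 0..π, ((-q * Real.cos θ) * x + 2 * (-q * Real.cos θ) ^ 2 * t
      - (-q * Real.cos θ) * L) = π * q ^ 2 * t := by
  have hsplit : ∀ θ, (-q * Real.cos θ) * x + 2 * (-q * Real.cos θ) ^ 2 * t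
      - (-q * Real.cos θ) * L
      = q * (L - x) * Real.cos θ + 2 * q ^ 2 * t * Real.cos θ ^ 2 := fun θ => by ring
  simp only [hsplit]
  rw [intervalIntegral.integral_add (Continuous.intervalIntegrable (by fun_prop) _ _)
    (Continuous.intervalIntegrable (by fun_prop) _ _), intervalIntegral.integral_const_mul,
    intervalIntegral.integral_const_mul, integral_cos, integral_cos_sq]
  simp
  ring

/-- Evaluation of `δ∞` for the x-periodic NLS problem with `λ = 1` and constant
initial data: the function
`s ↦ (ln(2√(q₀²-s²)/q₀) - 2i(sx + 2s²t - sL))/√(q₀²-s²)` is integrable on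
`(-q₀, q₀)` and the exponential of `1/(2π)` times its integral equals `e^{-iq₀²t}`. -/
theorem delta_infinity_evaluation (q0 L x t : ℝ) (hq0 : 0 < q0) (hL : 0 < L) :
    IntervalIntegrable
      (fun s : ℝ =>
        ((Real.log (2 * Real.sqrt (q0 ^ 2 - s ^ 2) / q0) : ℂ)
          - 2 * Complex.I * ((s : ℂ) * (x : ℂ) + 2 * (s : ℂ) ^ 2 * (t : ℂ) - (s : ℂ) * (L : ℂ)))
        / (Real.sqrt (q0 ^ 2 - s ^ 2) : ℂ))
      MeasureTheory.volume (-q0) q0 ∧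
    Complex.exp ((1 / (2 * Real.pi) : ℝ) *
        ∫ s in (-q0)..q0,
          ((Real.log (2 * Real.sqrt (q0 ^ 2 - s ^ 2) / q0) : ℂ)
            - 2 * Complex.I *
              ((s : ℂ) * (x : ℂ) + 2 * (s : ℂ) ^ 2 * (t : ℂ) - (s : ℂ) * (L : ℂ)))
          / (Real.sqrt (q0 ^ 2 - s ^ 2) : ℂ))
      = Complex.exp (-Complex.I * (q0 : ℂ) ^ 2 * (t : ℂ)) := by
  set h : ℝ → ℝ → ℂ := fun s r => (Real.log (2 * r / q0) : ℂ)
    - 2 * Complex.I * ((s : ℂ) * (x : ℂ) + 2 * (s : ℂ) ^ 2 * (t : ℂ) - (s : ℂ) * (L : ℂ)) with h_def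
  have hlog : IntervalIntegrable
      (fun θ => (Real.log (2 * (q0 * Real.sin θ) / q0) : ℂ)) volume 0 π := by
    have hreal := intervalIntegrable_log_two_mul_mul_sin_div hq0
    exact ⟨hreal.1.ofReal, hreal.2.ofReal⟩
  have hphase : IntervalIntegrable (fun θ => 2 * Complex.I * (((-q0 * Real.cos θ) * x
      + 2 * (-q0 * Real.cos θ) ^ 2 * t - (-q0 * Real.cos θ) * L : ℝ) : ℂ)) volume 0 π :=
    Continuous.intervalIntegrable (by fun_prop) _ _
  have hsplit : (fun θ => h (-q0 * Real.cos θ) (q0 * Real.sin θ)) = fun θ =>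
      (Real.log (2 * (q0 * Real.sin θ) / q0) : ℂ) - 2 * Complex.I * (((-q0 * Real.cos θ) * x
        + 2 * (-q0 * Real.cos θ) ^ 2 * t - (-q0 * Real.cos θ) * L : ℝ) : ℂ) := by
    funext θ
    simp only [h_def]
    push_cast
    ring
  refine ⟨(intervalIntegrable_div_sqrt_iff hq0 h).2 (hsplit ▸ hlog.sub hphase), ?_⟩
  have hint := integral_div_sqrt_eq hq0 h
  rw [hsplit, intervalIntegral.integral_sub hlog hphase, intervalIntegral.integral_const_mul,
    intervalIntegral.integral_ofReal, intervalIntegral.integral_ofReal,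
    integral_log_two_mul_mul_sin_div hq0, integral_phase_neg_mul_cos] at hint
  rw [hint]
  congr 1
  have hpi : (π : ℂ) ≠ 0 := Complex.ofReal_ne_zero.2 Real.pi_ne_zero
  push_cast
  field_simp
  ring
end
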